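/- Let u be a solution of the DP equation with momentum m = u - u_{xx} satisfying m_t + u m_x + 3 u_x m = 0, and let q solve q_t = u(q,t), q(x,0) = x. Then m(q(x,t),t) · q_x(x,t)³ = m₀(x) for all t, where m₀(x) = m(x,0). -/

import Mathlib

noncomputable def pdx (u : ℝ → ℝ → ℝ) : ℝ → ℝ → ℝ := fun x t => deriv (fun y => u y t) x
noncomputable def pdt (u : ℝ → ℝ → ℝ) : ℝ → ℝ → ℝ := fun x t => deriv (fun s => u x s) t

open Set Filter Topology MeasureTheory

/-- Domination by an absolutely continuous function gives absolute continuity. -/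
lemma ac_of_dom {f g : ℝ → ℝ} {a b K : ℝ} (hg : AbsolutelyContinuousOnInterval g a b)
    (h : ∀ x ∈ uIcc a b, ∀ y ∈ uIcc a b, dist (f x) (f y) ≤ K * dist (g x) (g y)) :
    AbsolutelyContinuousOnInterval f a b := by
  unfold AbsolutelyContinuousOnInterval at hg ⊢
  apply squeeze_zero' ?_ ?_ (by simpa using hg.const_mul K)
  · exact Filter.Eventually.of_forall <| fun _ ↦ Finset.sum_nonneg (fun i hi ↦ dist_nonneg)
  rw [eventually_inf_principal]
  filter_upwards with E hE
  simp only [Finset.mul_sum]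
  exact Finset.sum_le_sum fun i hi => h _ (hE.1 i hi).1 _ (hE.1 i hi).2

/-- The linear ODE `M' = -3 a M` with `a` merely integrable. -/
lemma ode_aux {M a : ℝ → ℝ} {t : ℝ} (ht : 0 ≤ t)
    (hM : ∀ s ∈ Icc 0 t, HasDerivAt M (-(3 * a s * M s)) s)
    (ha : IntervalIntegrable a volume 0 t) :
    M t * Real.exp (∫ s in (0:ℝ)..t, a s) ^ 3 = M 0 := by
  have hI : uIcc 0 t = Icc 0 t := uIcc_of_le ht
  have hMc : ContinuousOn M (uIcc 0 t) := by
    rw [hI]; exact fun s hs => (hM s hs).continuousAt.continuousWithinAt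
  have hint : IntervalIntegrable (fun s => -(3 * a s * M s)) volume 0 t :=
    ((ha.const_mul 3).mul_continuousOn hMc).neg
  have hAC1 : AbsolutelyContinuousOnInterval M 0 t := by
    refine ac_of_dom (K := 1)
      (hint.absolutelyContinuousOnInterval_intervalIntegral (c := 0) left_mem_uIcc) ?_
    have key : ∀ x ∈ uIcc 0 t, ∫ s in (0:ℝ)..x, -(3 * a s * M s) = M x - M 0 := by
      intro x hx
      have hsub : uIcc 0 x ⊆ uIcc 0 t := uIcc_subset_uIcc_left hx
      refine intervalIntegral.integral_eq_sub_of_hasDerivAt (fun s hs => hM s ?_)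
        (hint.mono_set hsub)
      rw [← hI]; exact hsub hs
    intro x hx y hy
    rw [key x hx, key y hy]
    simp
  have hA := ha.absolutelyContinuousOnInterval_intervalIntegral (c := 0) left_mem_uIcc
  have hAC2 : AbsolutelyContinuousOnInterval
      (fun x => Real.exp (∫ s in (0:ℝ)..x, a s)) 0 t := by
    obtain ⟨C, hC⟩ := hA.exists_bound
    refine ac_of_dom (K := Real.exp C) hA ?_
    intro x hx y hy
    have hx' := hC x hx
    have hy' := hC y hy
    rw [Real.norm_eq_abs] at hx' hy'
    rw [Real.dist_eq, Real.dist_eq]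
    have := Convex.norm_image_sub_le_of_norm_hasDerivWithin_le (f := Real.exp)
      (f' := Real.exp) (C := Real.exp C) (s := Iic C)
      (fun z _ => (Real.hasDerivAt_exp z).hasDerivWithinAt)
      (fun z hz => by rw [Real.norm_eq_abs, abs_of_pos (Real.exp_pos _)]; exact Real.exp_le_exp.2 hz)
      (convex_Iic C) (show (∫ s in (0:ℝ)..y, a s) ∈ Iic C from (le_abs_self _).trans hy')
      (show (∫ s in (0:ℝ)..x, a s) ∈ Iic C from (le_abs_self _).trans hx')
    simpa [Real.norm_eq_abs] using this
  have hG := hAC1.fun_mul (hAC2.fun_mul (hAC2.fun_mul hAC2))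
  obtain ⟨C, hC⟩ := hG.const_of_ae_hasDerivAt_zero (by
    filter_upwards [ha.ae_hasDerivAt_integral] with x hx hxI
    have h1 := (hx hxI 0 left_mem_uIcc).exp
    have h2 := (hM x (hI ▸ hxI)).fun_mul (h1.fun_mul (h1.fun_mul h1))
    refine h2.congr_deriv ?_
    ring)
  have e1 := hC t right_mem_uIcc
  have e0 := hC 0 left_mem_uIcc
  simp at e0
  rw [e0, ← e1]; ring

lemma joint_cont {q f : ℝ → ℝ → ℝ} {S : Set ℝ}
    (hqd : ∀ x, ∀ t ∈ S, HasDerivAt (fun y => q y t) (f x t) x)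
    (hf : ∀ x, ∀ t ∈ S, 0 < f x t)
    (hqc : ∀ x, ∀ t ∈ S, ContinuousAt (fun s => q x s) t)
    (x₀ t₁ : ℝ) (ht₁ : t₁ ∈ S) :
    ContinuousWithinAt (fun p : ℝ × ℝ => q p.1 p.2) (univ ×ˢ S) (x₀, t₁) := by
  have hmono : ∀ t ∈ S, StrictMono (fun y => q y t) := fun t ht =>
    strictMono_of_hasDerivAt_pos (fun x => hqd x t ht) (fun x => hf x t ht)
  rw [Metric.continuousWithinAt_iff]
  intro ε hε
  obtain ⟨r, hr, hr'⟩ := Metric.continuousAt_iff.1 (hqd x₀ t₁ ht₁).continuousAt (ε / 2) (by linarith)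
  obtain ⟨a, ha, ha'⟩ := Metric.continuousAt_iff.1 (hqc (x₀ + r / 2) t₁ ht₁) (ε / 2) (by linarith)
  obtain ⟨b, hb, hb'⟩ := Metric.continuousAt_iff.1 (hqc (x₀ - r / 2) t₁ ht₁) (ε / 2) (by linarith)
  have h1 := @hr' (x₀ + r / 2) (by rw [Real.dist_eq, abs_lt]; constructor <;> linarith)
  have h2 := @hr' (x₀ - r / 2) (by rw [Real.dist_eq, abs_lt]; constructor <;> linarith)
  refine ⟨min (r / 2) (min a b), by positivity, ?_⟩
  rintro ⟨x, t⟩ ⟨-, ht⟩ hd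
  rw [Prod.dist_eq, max_lt_iff] at hd
  simp only [lt_min_iff] at hd
  obtain ⟨⟨hx, -, -⟩, -, hta, htb⟩ := hd
  have h3 := ha' hta
  have h4 := hb' htb
  simp only [Real.dist_eq, abs_lt] at *
  have h5 := (hmono t ht).monotone (show x ≤ x₀ + r / 2 by linarith)
  have h6 := (hmono t ht).monotone (show x₀ - r / 2 ≤ x by linarith)
  try simp only at h5 h6
  constructor <;> linarith

/-- Local rigidity near a point where the momentum differs from its initial value. -/
lemma local_rigid {q f m : ℝ → ℝ → ℝ} {S : Set ℝ}
    (hm : Continuous (Function.uncurry m))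
    (hqd : ∀ x, ∀ t ∈ S, HasDerivAt (fun y => q y t) (f x t) x)
    (hf : ∀ x, ∀ t ∈ S, 0 < f x t)
    (hqc : ∀ x, ∀ t ∈ S, ContinuousAt (fun s => q x s) t)
    (dich : ∀ x, ∀ t ∈ S, f x t = 1 ∨ m (q x t) t * f x t ^ 3 = m x 0)
    (x₀ t₁ : ℝ) (ht₁ : t₁ ∈ S) (hne : m (q x₀ t₁) t₁ ≠ m x₀ 0) :
    ∃ r > 0, ((f x₀ t₁ = 1 ∧ ∀ t ∈ S, |t - t₁| < r → ∀ x, |x - x₀| ≤ r → f x t = 1) ∨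
      (∀ t ∈ S, |t - t₁| < r → f x₀ t ≠ 1)) := by
  have hj := joint_cont hqd hf hqc x₀ t₁ ht₁
  have hM : ContinuousWithinAt (fun p : ℝ × ℝ => m (q p.1 p.2) p.2) (univ ×ˢ S) (x₀, t₁) :=
    hm.continuousAt.comp_continuousWithinAt (hj.prodMk continuousWithinAt_snd)
  have hm0 : ContinuousWithinAt (fun p : ℝ × ℝ => m p.1 0) (univ ×ˢ S) (x₀, t₁) :=
    (hm.comp (continuous_fst.prodMk continuous_const)).continuousWithinAt
  have hH := (hM.sub hm0).abs
  set h := |m (q x₀ t₁) t₁ - m x₀ 0| / 2 with hh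
  have hpos : 0 < h := by have := abs_pos.2 (sub_ne_zero.2 hne); positivity
  set C := |m (q x₀ t₁) t₁| + 1 with hC
  have hCpos : 0 < C := by positivity
  have e1 := hH.eventually_const_lt (show h < |m (q x₀ t₁) t₁ - m x₀ 0| by linarith)
  have e2 := hM.abs.eventually_lt_const (show |m (q x₀ t₁) t₁| < C by linarith)
  obtain ⟨ρ, hρ, hρ'⟩ := Metric.mem_nhdsWithin_iff.1 (e1.and e2)
  set δ := min 1 (h / (7 * C)) with hδ
  have hδ0 : 0 < δ := by positivity
  have hδ1 : δ ≤ 1 := min_le_left _ _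
  have hδ2 : 7 * δ * C ≤ h := by
    have : δ ≤ h / (7 * C) := min_le_right _ _
    rw [le_div_iff₀ (by positivity)] at this
    linarith
  have gap : ∀ x, |x - x₀| < ρ → ∀ t ∈ S, |t - t₁| < ρ → f x t = 1 ∨ δ ≤ |f x t - 1| := by
    intro x hx t ht htρ
    rcases dich x t ht with h1 | h1
    · exact Or.inl h1
    right
    by_contra! hlt
    obtain ⟨hA, hB⟩ := @hρ' (x, t) ⟨by
      rw [Metric.mem_ball, Prod.dist_eq, max_lt_iff]; exact ⟨hx, htρ⟩, ⟨mem_univ _, ht⟩⟩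
    simp only [Pi.sub_apply] at hA hB
    rw [← h1] at hA
    have e : m (q x t) t - m (q x t) t * f x t ^ 3
      = - (m (q x t) t * ((f x t - 1) * (f x t ^ 2 + f x t + 1))) := by ring
    rw [e, abs_neg, abs_mul, abs_mul] at hA
    have hlt' := abs_lt.1 hlt
    have hfp := hf x t ht
    have h7 : |f x t ^ 2 + f x t + 1| ≤ 7 := by
      rw [abs_of_pos (by positivity)]; nlinarith
    have : |m (q x t) t| * (|f x t - 1| * |f x t ^ 2 + f x t + 1|) ≤ C * (δ * 7) := by
      gcongr
    linarith
  set r := ρ / 2 with hr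
  have hr0 : 0 < r := by positivity
  have tri : ∀ t ∈ S, |t - t₁| < ρ →
      ((∀ x, |x - x₀| ≤ r → f x t = 1) ∧ q (x₀ + r) t - q x₀ t = r) ∨
      (f x₀ t ≠ 1 ∧ r * δ / 2 ≤ |q (x₀ + r) t - q x₀ t - r|) := by
    intro t ht htρ
    obtain ⟨c, hc, hc'⟩ := exists_hasDerivAt_eq_slope (fun y => q y t) (fun y => f y t)
      (show x₀ < x₀ + r by linarith)
      (fun x _ => (hqd x t ht).continuousAt.continuousWithinAt) (fun x _ => hqd x t ht)
    have hcI : |c - x₀| ≤ r := by rw [abs_le]; constructor <;> linarith [hc.1, hc.2]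
    have hslope : q (x₀ + r) t - q x₀ t = r * f c t := by
      try simp only at hc'
      rw [hc', add_sub_cancel_left, mul_div_cancel₀ _ hr0.ne']
    have h0I : |x₀ - x₀| ≤ r := by simp [hr0.le]
    have conv : Convex ℝ {x : ℝ | |x - x₀| ≤ r} := by
      have : {x : ℝ | |x - x₀| ≤ r} = Metric.closedBall x₀ r := by
        ext x; simp [Real.dist_eq]
      rw [this]; exact convex_closedBall _ _
    have g : ∀ x, |x - x₀| ≤ r → f x t = 1 ∨ δ ≤ |f x t - 1| :=
      fun x hx => gap x (by linarith) t ht htρ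
    have s1 := hasDerivWithinAt_forall_lt_or_forall_gt_of_forall_ne (f := fun y => q y t)
      (f' := fun y => f y t) conv
      (fun x _ => (hqd x t ht).hasDerivWithinAt) (m := 1 + δ / 2) (fun x hx heq => by
        try simp only at heq
        rcases g x hx with h | h
        · linarith
        · rw [heq, abs_of_pos (by linarith)] at h; linarith)
    have s2 := hasDerivWithinAt_forall_lt_or_forall_gt_of_forall_ne (f := fun y => q y t)
      (f' := fun y => f y t) conv
      (fun x _ => (hqd x t ht).hasDerivWithinAt) (m := 1 - δ / 2) (fun x hx heq => by
        try simp only at heq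
        rcases g x hx with h | h
        · linarith
        · rw [heq, abs_of_neg (by linarith)] at h; linarith)
    rcases s1 with s1 | s1
    · rcases s2 with s2 | s2
      · right
        refine ⟨by have := s2 x₀ h0I; intro h; linarith, ?_⟩
        have := s2 c hcI
        try simp only at this
        rw [hslope, le_abs]; right; nlinarith
      · left
        have all1 : ∀ x, |x - x₀| ≤ r → f x t = 1 := by
          intro x hx
          rcases g x hx with h | h
          · exact h
          · have a1 := s1 x hx
            have a2 := s2 x hx
            try simp only at a1 a2
            have : |f x t - 1| < δ := by rw [abs_lt]; constructor <;> linarith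
            linarith
        exact ⟨all1, by rw [hslope, all1 c hcI, mul_one]⟩
    · right
      refine ⟨by have := s1 x₀ h0I; intro h; linarith, ?_⟩
      have := s1 c hcI
      try simp only at this
      rw [hslope, le_abs]; left; nlinarith
  have hdc : ContinuousAt (fun t => q (x₀ + r) t - q x₀ t - r) t₁ :=
    ((hqc _ t₁ ht₁).sub (hqc _ t₁ ht₁)).sub continuousAt_const
  obtain ⟨η, hη, hη'⟩ := Metric.continuousAt_iff.1 hdc (r * δ / 2) (by positivity)
  refine ⟨min r η, by positivity, ?_⟩
  have small : ∀ t, |t - t₁| < min r η → |t - t₁| < ρ ∧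
      |(q (x₀ + r) t - q x₀ t - r) - (q (x₀ + r) t₁ - q x₀ t₁ - r)| < r * δ / 2 := by
    intro t ht
    obtain ⟨k1, k2⟩ := lt_min_iff.1 ht
    exact ⟨by linarith, hη' k2⟩
  rcases tri t₁ ht₁ (by simpa using hρ) with ⟨A, B⟩ | ⟨A, B⟩
  · left
    refine ⟨A x₀ (by simp [hr0.le]), fun t ht htr x hx => ?_⟩
    obtain ⟨k1, k2⟩ := small t htr
    rcases tri t ht k1 with ⟨A', B'⟩ | ⟨A', B'⟩
    · exact A' x (hx.trans (min_le_left _ _))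
    · rw [B, sub_self, sub_zero] at k2
      linarith
  · right
    intro t ht htr h1
    obtain ⟨k1, k2⟩ := small t htr
    rcases tri t ht k1 with ⟨A', B'⟩ | ⟨A', B'⟩
    · rw [B', sub_self, zero_sub, abs_neg] at k2
      linarith
    · exact A' h1

/-- Conservation of momentum along the flow: if `m_t + u m_x + 3 uₓ m = 0` and `q` is the
flow of `u` with `q_x(x,t) = exp(∫₀ᵗ uₓ(q(x,s),s) ds)`, then
`m(q(x,t),t) q_x(x,t)³ = m₀(x)` for all `t ∈ [0,T)`. -/
theorem momentum_along_flow (T : ℝ) (hT : 0 < T) (u m q : ℝ → ℝ → ℝ)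
    (hm : ContDiff ℝ 1 (Function.uncurry m))
    (hmeq : ∀ x t : ℝ, pdt m x t + u x t * pdx m x t + 3 * pdx u x t * m x t = 0)
    (hq0 : ∀ x : ℝ, q x 0 = x)
    (hqt : ∀ x : ℝ, ∀ t ∈ Set.Ico (0:ℝ) T, HasDerivAt (fun s => q x s) (u (q x t) t) t)
    (hqx : ∀ x : ℝ, ∀ t ∈ Set.Ico (0:ℝ) T,
      pdx q x t = Real.exp (∫ s in (0:ℝ)..t, pdx u (q x s) s)) :
    ∀ x : ℝ, ∀ t ∈ Set.Ico (0:ℝ) T, m (q x t) t * (pdx q x t) ^ 3 = m x 0 := by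
  have hdiffm : Differentiable ℝ (Function.uncurry m) := hm.differentiable (by norm_num)
  have hMd : ∀ x : ℝ, ∀ t ∈ Set.Ico (0:ℝ) T,
      HasDerivAt (fun s => m (q x s) s) (-(3 * pdx u (q x t) t * m (q x t) t)) t := by
    intro x t ht
    have hF := (hdiffm (q x t, t)).hasFDerivAt
    set L := fderiv ℝ (Function.uncurry m) (q x t, t) with hL
    have h1 : HasDerivAt (fun y => m y t) (L (1, 0)) (q x t) :=
      HasFDerivAt.comp_hasDerivAt (f := fun y : ℝ => (y, t)) (q x t) hF
        ((hasDerivAt_id _).prodMk (hasDerivAt_const _ _))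
    have h2 : HasDerivAt (fun s => m (q x t) s) (L (0, 1)) t :=
      HasFDerivAt.comp_hasDerivAt (f := fun s : ℝ => (q x t, s)) t hF
        ((hasDerivAt_const _ _).prodMk (hasDerivAt_id _))
    have h3 : HasDerivAt (fun s => m (q x s) s) (L (u (q x t) t, 1)) t :=
      HasFDerivAt.comp_hasDerivAt (f := fun s : ℝ => (q x s, s)) t hF
        ((hqt x t ht).prodMk (hasDerivAt_id _))
    have e := hmeq (q x t) t
    have e1 : pdx m (q x t) t = L (1, 0) := h1.deriv
    have e2 : pdt m (q x t) t = L (0, 1) := h2.deriv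
    have e3 : L (u (q x t) t, 1) = u (q x t) t * L (1, 0) + L (0, 1) := by
      have : ((u (q x t) t, 1) : ℝ × ℝ) = u (q x t) t • ((1, 0) : ℝ × ℝ) + (0, 1) := by
        ext <;> simp
      rw [this, map_add, map_smul, smul_eq_mul]
    refine h3.congr_deriv ?_
    rw [e3, ← e1, ← e2]
    linarith
  have hpos : ∀ x : ℝ, ∀ t ∈ Set.Ico (0:ℝ) T, 0 < pdx q x t := fun x t ht => by
    rw [hqx x t ht]; exact Real.exp_pos _
  have hqd : ∀ x : ℝ, ∀ t ∈ Set.Ico (0:ℝ) T,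
      HasDerivAt (fun y => q y t) (pdx q x t) x := fun x t ht =>
    (differentiableAt_of_deriv_ne_zero (hpos x t ht).ne').hasDerivAt
  have hqc : ∀ x : ℝ, ∀ t ∈ Set.Ico (0:ℝ) T, ContinuousAt (fun s => q x s) t :=
    fun x t ht => (hqt x t ht).continuousAt
  have dich : ∀ x : ℝ, ∀ t ∈ Set.Ico (0:ℝ) T,
      pdx q x t = 1 ∨ m (q x t) t * pdx q x t ^ 3 = m x 0 := by
    intro x t ht
    by_cases hi : IntervalIntegrable (fun s => pdx u (q x s) s) volume 0 t
    · right
      have := ode_aux (M := fun s => m (q x s) s) ht.1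
        (fun s hs => hMd x s ⟨hs.1, hs.2.trans_lt ht.2⟩) hi
      simp only [hq0] at this
      rw [hqx x t ht, this]
    · left
      rw [hqx x t ht, intervalIntegral.integral_undef hi, Real.exp_zero]
  intro x₀ t₁ ht₁
  by_contra hbad
  have hf1 : pdx q x₀ t₁ = 1 := (dich x₀ t₁ ht₁).resolve_right hbad
  have hne : m (q x₀ t₁) t₁ ≠ m x₀ 0 := by
    rw [hf1] at hbad; simpa using hbad
  set c := m (q x₀ t₁) t₁ with hc
  have hrig := local_rigid hm.continuous hqd hpos hqc dich x₀
  -- local constancy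
  have hconst : ∀ t ∈ Set.Ico (0:ℝ) T, m (q x₀ t) t = c → pdx q x₀ t = 1 → ∃ r > 0,
      ∀ s ∈ Set.Ico (0:ℝ) T, |s - t| < r → m (q x₀ s) s = c ∧ pdx q x₀ s = 1 := by
    intro t ht hMt hft
    obtain ⟨r, hr, h⟩ := hrig t ht (by rw [hMt]; exact hne)
    rcases h with ⟨-, h⟩ | h
    swap
    · exact absurd hft (h t ht (by simpa using hr))
    refine ⟨r, hr, ?_⟩
    have htrans : ∀ s ∈ Set.Ico (0:ℝ) T, |s - t| < r → ∀ x, |x - x₀| ≤ r →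
        q x s = q x₀ s + (x - x₀) := by
      intro s hs hst x hx
      have hcv : Convex ℝ (Metric.closedBall x₀ r) := convex_closedBall _ _
      have := hcv.norm_image_sub_le_of_norm_hasDerivWithin_le (f := fun y => q y s - y)
        (f' := fun y => pdx q y s - 1) (C := 0)
        (fun y _ => ((hqd y s hs).sub (hasDerivAt_id y)).hasDerivWithinAt)
        (fun y hy => by
          rw [h s hs hst y (by simpa [Real.dist_eq] using hy)]; simp)
        (Metric.mem_closedBall_self hr.le) (show x ∈ Metric.closedBall x₀ r by
          simpa [Real.dist_eq] using hx)
      rw [zero_mul, norm_le_zero_iff] at this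
      linarith
    have hux : ∀ s ∈ Set.Ico (0:ℝ) T, |s - t| < r → pdx u (q x₀ s) s = 0 := by
      intro s hs hst
      have huc : ∀ x, |x - x₀| ≤ r → u (q x s) s = u (q x₀ s) s := by
        intro x hx
        have d1 := (hqt x s hs).hasDerivWithinAt (s := Set.Ico 0 T)
        have d2 := ((hqt x₀ s hs).add_const (x - x₀)).hasDerivWithinAt (s := Set.Ico 0 T)
        have hev : (fun τ => q x τ) =ᶠ[𝓝[Set.Ico 0 T] s] (fun τ => q x₀ τ + (x - x₀)) := by
          have hball : ∀ᶠ τ in 𝓝 s, |τ - t| < r :=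
            (by fun_prop : ContinuousAt (fun τ : ℝ => |τ - t|) s).eventually_lt_const hst
          filter_upwards [self_mem_nhdsWithin, nhdsWithin_le_nhds hball] with τ h1 h2
          exact htrans τ h1 h2 x hx
        have d3 := d2.congr_of_eventuallyEq hev (htrans s hs hst x hx)
        exact (uniqueDiffOn_Ico 0 T s hs).eq_deriv _ d1 d3
      have hev : (fun y => u y s) =ᶠ[𝓝 (q x₀ s)] (fun _ => u (q x₀ s) s) := by
        filter_upwards [Metric.closedBall_mem_nhds (q x₀ s) hr] with y hy
        have hy' : |y - q x₀ s| ≤ r := by simpa [Real.dist_eq] using hy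
        have hx : |x₀ + (y - q x₀ s) - x₀| ≤ r := by simpa using hy'
        have e := huc _ hx
        rw [htrans s hs hst _ hx] at e
        simpa using e
      show deriv (fun y => u y s) (q x₀ s) = 0
      rw [hev.deriv_eq]; simp
    intro s hs hst
    refine ⟨?_, h s hs hst x₀ (by simp [hr.le])⟩
    have hcv : Convex ℝ (Set.Ico (0:ℝ) T ∩ Metric.ball t r) :=
      (convex_Ico _ _).inter (convex_ball _ _)
    have := hcv.norm_image_sub_le_of_norm_hasDerivWithin_le (f := fun y => m (q x₀ y) y)
      (C := 0) (fun y hy => (hMd x₀ y hy.1).hasDerivWithinAt)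
      (fun y hy => by rw [hux y hy.1 (by simpa [Real.dist_eq] using hy.2)]; simp)
      ⟨ht, Metric.mem_ball_self hr⟩ (show s ∈ _ from ⟨hs, by simpa [Real.dist_eq] using hst⟩)
    rw [zero_mul, norm_le_zero_iff] at this
    linarith
  let P : Set (Set.Ico (0:ℝ) T) := {t | m (q x₀ t) t = c ∧ pdx q x₀ t = 1}
  have hPo : IsOpen P := by
    rw [Metric.isOpen_iff]
    rintro ⟨t, ht⟩ ⟨h1, h2⟩
    obtain ⟨r, hr, h⟩ := hconst t ht h1 h2
    exact ⟨r, hr, fun s hs => h s s.2 hs⟩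
  have hPc : IsOpen Pᶜ := by
    rw [Metric.isOpen_iff]
    rintro ⟨t, ht⟩ hnP
    by_cases h1 : m (q x₀ t) t = c
    · have h2 : pdx q x₀ t ≠ 1 := fun h2 => hnP ⟨h1, h2⟩
      obtain ⟨r, hr, h⟩ := hrig t ht (by rw [h1]; exact hne)
      rcases h with ⟨h, -⟩ | h
      · exact absurd h h2
      · exact ⟨r, hr, fun s hs hsP => h s s.2 hs hsP.2⟩
    · have := (hMd x₀ t ht).continuousAt.eventually_ne h1
      obtain ⟨r, hr, h⟩ := Metric.eventually_nhds_iff.1 this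
      exact ⟨r, hr, fun s hs hsP => h hs hsP.1⟩
  haveI : PreconnectedSpace (Set.Ico (0:ℝ) T) :=
    Subtype.preconnectedSpace isPreconnected_Ico
  have hPu : P = Set.univ :=
    IsClopen.eq_univ ⟨⟨hPc⟩, hPo⟩ ⟨⟨t₁, ht₁⟩, ⟨rfl, hf1⟩⟩
  have h0 : (⟨0, ⟨le_refl 0, hT⟩⟩ : Set.Ico (0:ℝ) T) ∈ P := by rw [hPu]; exact Set.mem_univ _
  have h00 : m (q x₀ 0) 0 = c := h0.1
  rw [hq0] at h00
  exact hne h00.symm
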